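/- For every k ≥ 3 and 0 < γ < 1 and n ≥ r(k), there exists an oriented graph G on n vertices with minimum total degree at least ⌊(1 − (k−2)/(k(r(k)−2)))·n − (2γn + k)/(k(r(k)−2))⌋ such that no collection of vertex-disjoint copies of T_k in G covers more than (1−γ)·n vertices. -/

import Mathlib

open Finset

/-- An oriented graph: at most one directed edge between any pair of vertices. -/
structure OrientedGraph (V : Type*) where
  adj : V → V → Prop
  asymm : ∀ u v, adj u v → ¬ adj v u

namespace OrientedGraph

variable {V : Type*}

/-- A tournament: a complete oriented graph. -/
def IsTournament (G : OrientedGraph V) : Prop :=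
  ∀ u v : V, u ≠ v → G.adj u v ∨ G.adj v u

/-- `U` is the vertex set of a copy of the transitive tournament on `k` vertices in `G`. -/
def IsTTCopy (G : OrientedGraph V) (k : ℕ) (U : Finset V) : Prop :=
  ∃ f : Fin k ↪ V, Finset.univ.map f = U ∧
    ∀ i j : Fin k, i < j → G.adj (f i) (f j)

/-- Total degree of a vertex: the number of edges incident to it. -/
noncomputable def degree [Fintype V] (G : OrientedGraph V) (v : V) : ℕ :=
  Nat.card {u : V // G.adj v u ∨ G.adj u v}

/-- Minimum total degree. -/
noncomputable def minDegree [Fintype V] (G : OrientedGraph V) : ℕ :=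
  sInf (Set.range G.degree)

/-- Number of (directed) edges. -/
noncomputable def edgeCount [Fintype V] (G : OrientedGraph V) : ℕ :=
  Nat.card {p : V × V // G.adj p.1 p.2}

section
variable [Fintype V] [DecidableEq V]

/-- A fractional `T_k`-tiling: a weight function on copies of the transitive tournament
`T_k` such that every vertex has total incident weight at most `1`. -/
def IsFracTiling (G : OrientedGraph V) (k : ℕ) (w : Finset V → ℝ) : Prop :=
  (∀ U, 0 ≤ w U) ∧ (∀ U, ¬ G.IsTTCopy k U → w U = 0) ∧
    ∀ v : V, ∑ U ∈ Finset.univ.filter (fun U => v ∈ U), w U ≤ 1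

/-- A perfect fractional `T_k`-tiling: total weight `n/k`. -/
def HasPerfectFracTiling (G : OrientedGraph V) (k : ℕ) : Prop :=
  ∃ w : Finset V → ℝ, G.IsFracTiling k w ∧
    ∑ U : Finset V, w U = (Fintype.card V : ℝ) / k

/-- A perfect `T_k`-tiling: vertex-disjoint copies of `T_k` covering all vertices. -/
def HasPerfectTiling (G : OrientedGraph V) (k : ℕ) : Prop :=
  ∃ P : Finset (Finset V), (∀ U ∈ P, G.IsTTCopy k U) ∧
    (P : Set (Finset V)).PairwiseDisjoint id ∧ P.sup id = Finset.univ

end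

end OrientedGraph

/-- The oriented Ramsey number `r(k)`: the least `m` such that every tournament on `m`
vertices contains a copy of the transitive tournament `T_k`. -/
noncomputable def oRamsey (k : ℕ) : ℕ :=
  sInf {m | ∀ G : OrientedGraph (Fin m), G.IsTournament → ∃ U, G.IsTTCopy k U}

/-- `trs k`: the least (positive) `n` such that every tournament on `n` vertices has a
perfect fractional `T_k`-tiling. -/
noncomputable def trs (k : ℕ) : ℕ :=
  sInf {n | 0 < n ∧ ∀ G : OrientedGraph (Fin n), G.IsTournament → G.HasPerfectFracTiling k}

/-- `trInt k`: the least (positive) `n` such that every tournament on `n` vertices has a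
perfect `T_k`-tiling. -/
noncomputable def trInt (k : ℕ) : ℕ :=
  sInf {n | 0 < n ∧ ∀ G : OrientedGraph (Fin n), G.IsTournament → G.HasPerfectTiling k}

namespace OrientedGraph

variable {V : Type*}

lemma not_adj_self (G : OrientedGraph V) (v : V) : ¬ G.adj v v :=
  fun h => G.asymm v v h h

/-- The transitive tournament induced by a linear order. -/
def ofLinearOrder (V : Type*) [LinearOrder V] : OrientedGraph V where
  adj u v := u < v
  asymm _ _ h := h.asymm

lemma isTournament_ofLinearOrder [LinearOrder V] : (ofLinearOrder V).IsTournament :=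
  fun _ _ h => lt_or_gt_of_ne h

lemma IsTTCopy.card_eq {G : OrientedGraph V} {k : ℕ} {U : Finset V} (h : G.IsTTCopy k U) :
    U.card = k := by
  obtain ⟨f, rfl, -⟩ := h
  simp

lemma isTTCopy_of_pairwise (G : OrientedGraph V) {l : List V} {k : ℕ} (hl : l.length = k)
    (h : l.Pairwise G.adj) : ∃ U, G.IsTTCopy k U := by
  subst hl
  rw [List.pairwise_iff_get] at h
  have hinj : Function.Injective l.get := by
    intro i j hij
    rcases lt_trichotomy i j with hlt | heq | hlt
    · exact absurd (hij ▸ h i j hlt) (G.not_adj_self _)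
    · exact heq
    · exact absurd (hij ▸ h j i hlt) (G.not_adj_self _)
  exact ⟨_, ⟨l.get, hinj⟩, rfl, h⟩

lemma IsTournament.exists_pairwise_list {G : OrientedGraph V} (hG : G.IsTournament) (k : ℕ) :
    ∀ S : Finset V, 2 ^ k ≤ S.card →
      ∃ l : List V, l.length = k ∧ (∀ v ∈ l, v ∈ S) ∧ l.Pairwise G.adj := by
  classical
  induction k with
  | zero => exact fun S _ => ⟨[], by simp⟩
  | succ k ih =>
    intro S hS
    have hpos : 0 < 2 ^ k := by positivity
    rw [pow_succ] at hS
    obtain ⟨v, hv⟩ : S.Nonempty := Finset.card_pos.mp (by omega)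
    have hsub : S ⊆ insert v (S.filter (G.adj v ·) ∪ S.filter (G.adj · v)) := by
      intro u hu
      by_cases huv : u = v
      · simp [huv]
      · have := hG u v huv
        simp [hu, huv, this.symm]
    have h₁ := Finset.card_le_card hsub
    have h₂ := Finset.card_insert_le v (S.filter (G.adj v ·) ∪ S.filter (G.adj · v))
    have h₃ := Finset.card_union_le (S.filter (G.adj v ·)) (S.filter (G.adj · v))
    by_cases hout : 2 ^ k ≤ (S.filter (G.adj v ·)).card
    · obtain ⟨l, hl, hlS, hp⟩ := ih _ hout
      simp only [Finset.mem_filter] at hlS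
      refine ⟨v :: l, by simp [hl], ?_, List.pairwise_cons.mpr ⟨fun u hu => (hlS u hu).2, hp⟩⟩
      rintro u (_ | ⟨_, hu⟩)
      exacts [hv, (hlS u hu).1]
    · obtain ⟨l, hl, hlS, hp⟩ := ih (S.filter (G.adj · v)) (by omega)
      simp only [Finset.mem_filter] at hlS
      refine ⟨l ++ [v], by simp [hl], ?_, ?_⟩
      · intro u hu
        rcases List.mem_append.mp hu with hu | hu
        · exact (hlS u hu).1
        · rwa [List.mem_singleton.mp hu]
      · refine List.pairwise_append.mpr ⟨hp, List.pairwise_singleton _ _, ?_⟩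
        intro u hu w hw
        rw [List.mem_singleton.mp hw]
        exact (hlS u hu).2

lemma exists_forall_isTournament_isTTCopy (k : ℕ) :
    ∃ m, ∀ G : OrientedGraph (Fin m), G.IsTournament → ∃ U, G.IsTTCopy k U := by
  refine ⟨2 ^ k, fun G hG => ?_⟩
  obtain ⟨l, hl, -, hp⟩ := hG.exists_pairwise_list k Finset.univ (by simp)
  exact G.isTTCopy_of_pairwise hl hp

lemma le_oRamsey (k : ℕ) : k ≤ oRamsey k := by
  obtain ⟨U, hU⟩ := Nat.sInf_mem (exists_forall_isTournament_isTTCopy k) _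
    isTournament_ofLinearOrder
  exact hU.card_eq.symm.le.trans ((Finset.card_le_univ U).trans_eq (Fintype.card_fin _))

/-- The blow-up of `T` along `c`, in which the fibre over `a` is ordered linearly and all other
fibres are independent. -/
def blowUp {W : Type*} [LinearOrder V] (T : OrientedGraph W) (c : V → W) (a : W) :
    OrientedGraph V where
  adj u v := T.adj (c u) (c v) ∨ (c u = a ∧ c v = a ∧ u < v)
  asymm := by
    rintro u v (h | ⟨hu, hv, h⟩) (h' | ⟨hv', hu', h'⟩)
    · exact T.asymm _ _ h h'
    · exact T.not_adj_self a (by rwa [hu', hv'] at h)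
    · exact T.not_adj_self a (by rwa [hu, hv] at h')
    · exact h.asymm h'

lemma two_le_card_filter_of_isTTCopy_blowUp {W : Type*} [LinearOrder V] [DecidableEq W]
    {T : OrientedGraph W} {c : V → W} {a : W} {k : ℕ} (hT : ¬ ∃ U, T.IsTTCopy k U)
    {U : Finset V} (hU : (T.blowUp c a).IsTTCopy k U) :
    2 ≤ (U.filter (c · = a)).card := by
  by_contra! hlt
  obtain ⟨f, rfl, hf⟩ := hU
  have hadj : ∀ i j : Fin k, i < j → T.adj (c (f i)) (c (f j)) := by
    intro i j hij
    rcases hf i j hij with h | ⟨hi, hj, h⟩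
    · exact h
    · have := Finset.card_le_one.mp (Nat.le_of_lt_succ hlt) (f i) (by simp [hi])
        (f j) (by simp [hj])
      exact absurd this h.ne
  refine hT ⟨_, ⟨fun i => c (f i), fun i j hij => ?_⟩, rfl, hadj⟩
  dsimp only at hij
  rcases lt_trichotomy i j with hlt | heq | hlt
  · exact absurd (hij ▸ hadj i j hlt) (T.not_adj_self _)
  · exact heq
  · exact absurd (hij ▸ hadj j i hlt) (T.not_adj_self _)

lemma card_le_degree_add [Fintype V] (G : OrientedGraph V) (v : V) (N : Finset V)
    (hN : ∀ u, u ∉ N → G.adj v u ∨ G.adj u v) :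
    Fintype.card V ≤ G.degree v + N.card := by
  classical
  rw [degree, Nat.card_eq_fintype_card, Fintype.card_subtype, ← Finset.card_univ]
  refine (Finset.card_le_card fun u _ => ?_).trans (Finset.card_union_le _ N)
  by_cases hu : u ∈ N
  · simp [hu]
  · simp [hN u hu]

lemma card_le_degree_blowUp_add {W : Type*} [Fintype V] [LinearOrder V] [DecidableEq W]
    {T : OrientedGraph W} (hT : T.IsTournament) {c : V → W} {a : W} {q : ℕ} (hq : 1 ≤ q)
    (hc : ∀ b, b ≠ a → (Finset.univ.filter (c · = b)).card ≤ q) (v : V) :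
    Fintype.card V ≤ (T.blowUp c a).degree v + q := by
  by_cases hv : c v = a
  · refine (card_le_degree_add _ v {v} fun u hu => ?_).trans
      (Nat.add_le_add_left (by simpa using hq) _)
    have huv : u ≠ v := by simpa using hu
    by_cases hu' : c u = a
    · rcases lt_or_gt_of_ne huv with h | h
      · exact Or.inr (Or.inr ⟨hu', hv, h⟩)
      · exact Or.inl (Or.inr ⟨hv, hu', h⟩)
    · exact (hT (c v) (c u) (by rw [hv]; exact Ne.symm hu')).imp Or.inl Or.inl
  · refine (card_le_degree_add _ v (Finset.univ.filter (c · = c v)) fun u hu => ?_).trans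
      (Nat.add_le_add_left (hc _ hv) _)
    have hu' : c u ≠ c v := by simpa using hu
    exact (hT (c v) (c u) hu'.symm).imp Or.inl Or.inl

lemma two_mul_card_sup_le [DecidableEq V] {G : OrientedGraph V} {k : ℕ} {X : Finset V}
    (hX : ∀ U, G.IsTTCopy k U → 2 ≤ (U ∩ X).card) {P : Finset (Finset V)}
    (hP : ∀ U ∈ P, G.IsTTCopy k U) (hd : (P : Set (Finset V)).PairwiseDisjoint id) :
    2 * (P.sup id).card ≤ k * X.card := by
  have hsup : (P.sup id).card = P.card * k := by
    rw [Finset.sup_eq_biUnion, Finset.card_biUnion hd,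
      Finset.sum_const_nat fun U hU => IsTTCopy.card_eq (U := id U) (hP U hU)]
  have hle : P.card * 2 ≤ X.card := by
    calc P.card * 2 ≤ ∑ U ∈ P, (U ∩ X).card :=
          Finset.card_nsmul_le_sum _ _ _ fun U hU => hX U (hP U hU)
      _ = (P.biUnion (· ∩ X)).card :=
          (Finset.card_biUnion fun U hU W hW h =>
            (hd hU hW h).mono Finset.inter_subset_left Finset.inter_subset_left).symm
      _ ≤ X.card :=
          Finset.card_le_card (Finset.biUnion_subset.mpr fun _ _ => Finset.inter_subset_right)
  calc 2 * (P.sup id).card = k * (P.card * 2) := by rw [hsup]; ring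
    _ ≤ k * X.card := Nat.mul_le_mul_left k hle

end OrientedGraph

/-- If `n ≤ x + q * m`, then `Fin n` splits into one part of size at most `x` and `m` parts of
size at most `q`. -/
lemma exists_fin_partition {n x q m : ℕ} (hm : 0 < m) (h : n ≤ x + q * m) :
    ∃ c : Fin n → Fin (m + 1), (Finset.univ.filter (c · = 0)).card ≤ x ∧
      ∀ b, b ≠ 0 → (Finset.univ.filter (c · = b)).card ≤ q := by
  refine ⟨fun v => if (v : ℕ) < x then 0 else
    Fin.succ ⟨(v - x) % m, Nat.mod_lt _ hm⟩, ?_, fun b hb => ?_⟩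
  · rw [← Finset.card_range x]
    refine Finset.card_le_card_of_injOn (fun v => (v : ℕ)) ?_ Fin.val_injective.injOn
    intro v hv
    by_contra hvx
    simp_all
  · obtain ⟨b, rfl⟩ := Fin.exists_succ_eq.mpr hb
    have key : ∀ v : Fin n, (if (v : ℕ) < x then (0 : Fin (m + 1)) else
        Fin.succ ⟨(v - x) % m, Nat.mod_lt _ hm⟩) = b.succ → x ≤ v ∧ ((v : ℕ) - x) % m = b := by
      intro v hv
      split_ifs at hv with hvx
      · exact absurd hv.symm (Fin.succ_ne_zero b)
      · exact ⟨not_lt.mp hvx, congrArg Fin.val (Fin.succ_injective _ hv)⟩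
    rw [← Finset.card_range q]
    refine Finset.card_le_card_of_injOn (fun v => ((v : ℕ) - x) / m) ?_ ?_
    · intro v _
      simp only [Finset.coe_range, Set.mem_Iio]
      rw [Nat.div_lt_iff_lt_mul hm]
      have hxv := key v (by simp_all)
      omega
    · intro v hv w hw hvw
      have hv' := key v (by simpa using hv)
      have hw' := key w (by simpa using hw)
      have h₁ := Nat.div_add_mod ((v : ℕ) - x) m
      have h₂ := Nat.div_add_mod ((w : ℕ) - x) m
      dsimp only at hvw
      rw [hvw, hv'.2] at h₁
      rw [hw'.2] at h₂
      ext
      omega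

/-- For `k ≥ 3`, `0 < γ < 1`, and `n ≥ r(k)`, there is an oriented graph on `n` vertices
with minimum total degree at least
`⌊(1 - (k-2)/(k(r(k)-2)))·n - (2γn + k)/(k(r(k)-2))⌋` such that no collection of
vertex-disjoint copies of `T_k` covers more than `(1-γ)·n` vertices. -/
theorem stmt_9 (k : ℕ) (hk : 3 ≤ k) (γ : ℝ) (h0 : 0 < γ) (h1 : γ < 1)
    (n : ℕ) (hn : oRamsey k ≤ n) :
    ∃ G : OrientedGraph (Fin n),
      (∀ v : Fin n,
        (⌊(1 - ((k : ℝ) - 2) / ((k : ℝ) * ((oRamsey k : ℝ) - 2))) * (n : ℝ) -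
          (2 * γ * (n : ℝ) + (k : ℝ)) / ((k : ℝ) * ((oRamsey k : ℝ) - 2))⌋ : ℝ) ≤
          G.degree v) ∧
      ∀ P : Finset (Finset (Fin n)), (∀ U ∈ P, G.IsTTCopy k U) →
        (P : Set (Finset (Fin n))).PairwiseDisjoint id →
        ((P.sup id).card : ℝ) ≤ (1 - γ) * (n : ℝ) := by
  obtain ⟨m, hR⟩ : ∃ m, oRamsey k = m + 2 :=
    Nat.exists_eq_add_of_le' (by have := OrientedGraph.le_oRamsey k; omega)
  have hm : 0 < m := by have := OrientedGraph.le_oRamsey k; omega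
  obtain ⟨T, hT, hfree⟩ : ∃ T : OrientedGraph (Fin (m + 1)),
      T.IsTournament ∧ ¬ ∃ U, T.IsTTCopy k U := by
    have hlt : m + 1 < oRamsey k := by omega
    simpa using Nat.notMem_of_lt_sInf hlt
  have hmR : ((oRamsey k : ℝ) - 2) = m := by rw [hR]; push_cast; ring
  rw [hmR]
  have hk' : (3 : ℝ) ≤ k := by exact_mod_cast hk
  have hm' : (0 : ℝ) < m := by exact_mod_cast hm
  have hn' : (0 : ℝ) ≤ n := n.cast_nonneg
  set E : ℝ := (((k : ℝ) - 2) * n + 2 * γ * n + k) / (k * m) with hE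
  have hD : (1 - ((k : ℝ) - 2) / ((k : ℝ) * m)) * (n : ℝ) -
      (2 * γ * (n : ℝ) + (k : ℝ)) / ((k : ℝ) * m) = n - E := by
    rw [hE]; field_simp; ring
  rw [hD]
  have hEpos : 0 < E := by
    have : 0 ≤ ((k : ℝ) - 2) * n := mul_nonneg (by linarith) hn'
    have : 0 ≤ 2 * γ * n := by positivity
    exact div_pos (by linarith) (by positivity)
  set x : ℕ := ⌊(1 - γ) * (2 * n) / k⌋₊ with hx
  set q : ℕ := ⌈E⌉₊ with hq
  have hx_le : (x : ℝ) ≤ (1 - γ) * (2 * n) / k :=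
    Nat.floor_le (div_nonneg (mul_nonneg (by linarith) (by positivity)) (by positivity))
  have hx_lt : (1 - γ) * (2 * n) / k < x + 1 := Nat.lt_floor_add_one _
  have hqE : E ≤ q := Nat.le_ceil E
  have hsize : n ≤ x + q * m := by
    have hEm : E * m = n - (1 - γ) * (2 * n) / k + 1 := by
      rw [hE]; field_simp; ring
    have hqm : E * m ≤ q * m := mul_le_mul_of_nonneg_right hqE hm'.le
    have : (n : ℝ) ≤ x + q * m := by linarith
    exact_mod_cast this
  obtain ⟨c, hc₀, hc⟩ := exists_fin_partition hm hsize
  refine ⟨T.blowUp c 0, fun v => ?_, fun P hP hd => ?_⟩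
  · have hdeg := OrientedGraph.card_le_degree_blowUp_add hT (Nat.ceil_pos.mpr hEpos) hc v
    rw [Fintype.card_fin] at hdeg
    have hfloor : ⌊(n : ℝ) - E⌋ + q ≤ n := by
      have : (q : ℤ) = ⌈E⌉ := Int.natCast_ceil_eq_ceil hEpos.le
      rw [this, sub_eq_add_neg, Int.floor_natCast_add, Int.floor_neg]
      omega
    have : ⌊(n : ℝ) - E⌋ ≤ (T.blowUp c 0).degree v := by omega
    exact_mod_cast this
  · have hcov := OrientedGraph.two_mul_card_sup_le (X := Finset.univ.filter (c · = 0))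
      (fun U hU => by
        have := OrientedGraph.two_le_card_filter_of_isTTCopy_blowUp hfree hU
        rwa [Finset.inter_filter, Finset.inter_univ]) hP hd
    have hcov' : 2 * ((P.sup id).card : ℝ) ≤ k * x := by
      exact_mod_cast hcov.trans (Nat.mul_le_mul_left k hc₀)
    have : (k : ℝ) * x ≤ (1 - γ) * (2 * n) := by
      rw [mul_comm]
      exact (le_div_iff₀ (by positivity)).mp hx_le
    linarith
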